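/- Let r ≥ 1, let n_1,…,n_r be positive integers, and let m_0, m_1, …, m_r be nonnegative integers with m_0 + m_1 + ⋯ + m_r = n_1 + ⋯ + n_r. Then φ(0^{m_0} 1^{n_1} 0^{m_1} ⋯ 1^{n_r} 0^{m_r}) ≤ Σ_{(d_1,…,d_r) ∈ D_r} Π_{i=1}^r C(n_i + 1, d_i). -/

import Mathlib

/-- A pairing of the positions `Fin N`: a collection of blocks, each of size 2,
with every position in exactly one block. -/
def IsPairing {N : ℕ} (π : Finset (Finset (Fin N))) : Prop :=
  (∀ B ∈ π, B.card = 2) ∧ ∀ i : Fin N, ∃! B, B ∈ π ∧ i ∈ B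

/-- A crossing: blocks `{i₁,i₂}` and `{j₁,j₂}` with `i₁ < j₁ < i₂ < j₂`. -/
def HasCrossing {N : ℕ} (π : Finset (Finset (Fin N))) : Prop :=
  ∃ B ∈ π, ∃ C ∈ π, ∃ i₁ i₂ j₁ j₂ : Fin N,
    i₁ ∈ B ∧ i₂ ∈ B ∧ j₁ ∈ C ∧ j₂ ∈ C ∧ i₁ < j₁ ∧ j₁ < i₂ ∧ i₂ < j₂

/-- A non-crossing `w`-pairing: a non-crossing pairing of the positions of the
bitstring `w` (ones are `true`, zeros are `false`) pairing unequal letters. -/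
def IsNCPairingOn (w : List Bool) (π : Finset (Finset (Fin w.length))) : Prop :=
  IsPairing π ∧ ¬ HasCrossing π ∧
    ∀ B ∈ π, ∀ i ∈ B, ∀ j ∈ B, i ≠ j → w.get i ≠ w.get j

/-- `phi w` is the number of non-crossing `w`-pairings. -/
noncomputable def phi (w : List Bool) : ℕ :=
  Set.ncard {π : Finset (Finset (Fin w.length)) | IsNCPairingOn w π}

/-- The word `1^{n 0} 0^{m 0} 1^{n 1} 0^{m 1} ⋯ 1^{n (r-1)} 0^{m (r-1)}`. -/
def runsF {r : ℕ} (n m : Fin r → ℕ) : List Bool :=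
  (List.finRange r).flatMap fun i => List.replicate (n i) true ++ List.replicate (m i) false

/-- The word `1^{k₁} 0^{k₁} ⋯ 1^{k_r} 0^{k_r}` for `l = [k₁, …, k_r]`. -/
def symWord (l : List ℕ) : List Bool :=
  l.flatMap fun k => List.replicate k true ++ List.replicate k false

/-- The symmetrized pairing function `φ*(n₁,…,n_r) = φ(1^{n₁}0^{n₁}⋯1^{n_r}0^{n_r})`. -/
noncomputable def phiStar (l : List ℕ) : ℕ := phi (symWord l)

/-- `Yval w i` is the lattice-path value `Y_i`. -/
def Yval (w : List Bool) (i : ℕ) : ℤ :=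
  ((w.take i).count true : ℤ) - ((w.take i).count false : ℤ)

/-- The height of position `i` of `w`, relative to the minimum `mY` of the `Y_i`. -/
def heightAt (w : List Bool) (mY : ℤ) (i : Fin w.length) : ℤ :=
  if w.get i then Yval w (i.val + 1) - mY else Yval w (i.val + 1) - mY + 1

/-- `d : Fin r → ℕ` is a Catalan degree sequence of order `r`. -/
def IsCatalanSeq (r : ℕ) (d : Fin r → ℕ) : Prop :=
  (∀ i : ℕ, 1 ≤ i → i ≤ r - 1 →
      (i : ℕ) ≤ ∑ j ∈ Finset.univ.filter (fun j : Fin r => (j : ℕ) < i), d j) ∧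
  ∑ j, d j = r - 1

/-- Sum of the first `j` values of `f`. -/
def prefSum {r : ℕ} (f : Fin r → ℕ) (j : ℕ) : ℕ :=
  ∑ i ∈ Finset.univ.filter (fun i : Fin r => (i : ℕ) < j), f i

/-- `m` is a member of `CF(n)`. -/
def InCF {r : ℕ} (n m : Fin r → ℕ) : Prop :=
  (∀ j : ℕ, 1 ≤ j → j ≤ r - 1 → prefSum m j ≤ prefSum n j) ∧
  (∑ i, m i = ∑ i, n i)

/-- `forestCount L s` counts plane forests with `s` trees whose vertices, in preorder, carry the
labels `L`, a vertex with label `n` having its children in distinct slots among `n + 1`. -/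
def forestCount : List ℕ → ℕ → ℕ
  | [], 0 => 1
  | [], _ + 1 => 0
  | _ :: _, 0 => 0
  | n :: L, s + 1 => ∑ d ∈ Finset.range (n + 2), (n + 1).choose d * forestCount L (s + d)

theorem forestCount_add (L : List ℕ) (a b : ℕ) :
    forestCount L (a + b) = ∑ j ∈ Finset.range (L.length + 1),
      forestCount (L.take j) a * forestCount (L.drop j) b := by
  induction L generalizing a b with
  | nil => cases a <;> cases b <;> simp [forestCount]
  | cons n L ih =>
    cases a with
    | zero =>
      rw [List.length_cons, Finset.sum_range_succ']
      simp [forestCount]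
    | succ a =>
      rw [List.length_cons, Finset.sum_range_succ']
      rw [show a + 1 + b = (a + b) + 1 by ring]
      simp only [forestCount, List.take_succ_cons, List.drop_succ_cons, List.take_zero, zero_mul,
        add_zero, Finset.sum_mul]
      rw [Finset.sum_comm]
      refine Finset.sum_congr rfl fun d _ => ?_
      rw [show a + b + d = (a + d) + b by ring, ih, Finset.mul_sum]
      exact Finset.sum_congr rfl fun j _ => by ring

/-- The number of ways to attach a forest with labels `L` to a root having `k + 1` slots. -/
def rootCount (k : ℕ) (L : List ℕ) : ℕ :=
  ∑ d ∈ Finset.range (k + 2), (k + 1).choose d * forestCount L d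

theorem rootCount_zero (L : List ℕ) :
    rootCount 0 L = forestCount L 0 + forestCount L 1 := by
  simp [rootCount, Finset.sum_range_succ]

theorem rootCount_zero_cons (n : ℕ) (L : List ℕ) : rootCount 0 (n :: L) = rootCount n L := by
  rw [rootCount_zero]
  simp [forestCount, rootCount]

theorem rootCount_succ (k : ℕ) (L : List ℕ) :
    rootCount (k + 1) L = ∑ j ∈ Finset.range (L.length + 1),
      rootCount k (L.take j) * rootCount 0 (L.drop j) := by
  have h : ∑ j ∈ Finset.range (L.length + 1), rootCount k (L.take j) * rootCount 0 (L.drop j) =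
      ∑ d ∈ Finset.range (k + 2),
        (k + 1).choose d * (forestCount L (d + 0) + forestCount L (d + 1)) := by
    simp only [rootCount_zero]
    simp only [rootCount, Finset.sum_mul]
    rw [Finset.sum_comm]
    refine Finset.sum_congr rfl fun d _ => ?_
    rw [forestCount_add, forestCount_add, ← Finset.sum_add_distrib, Finset.mul_sum]
    exact Finset.sum_congr rfl fun j _ => by ring
  rw [h, rootCount, Finset.sum_range_succ']
  simp only [Nat.choose_succ_succ (k + 1), add_mul, mul_add, Finset.sum_add_distrib, add_zero]
  rw [Finset.sum_range_succ' (fun d => (k + 1).choose d * forestCount L d),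
    Finset.sum_range_succ (fun d => (k + 1).choose (d + 1) * forestCount L (d + 1))]
  simp
  ring

/-- Pullback of a family of blocks along an embedding of positions. -/
def pullBlocks {M N : ℕ} (e : Fin M ↪ Fin N) (π : Finset (Finset (Fin N))) :
    Finset (Finset (Fin M)) :=
  Finset.univ.filter fun B => B.map e ∈ π

theorem exists_map_eq {M N : ℕ} (e : Fin M ↪ Fin N) (B : Finset (Fin N))
    (hB : ∀ j ∈ B, j ∈ Set.range e) : ∃ A : Finset (Fin M), A.map e = B := by
  refine ⟨Finset.univ.filter fun i => e i ∈ B, ?_⟩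
  ext j
  simp only [Finset.mem_map, Finset.mem_filter, Finset.mem_univ, true_and]
  constructor
  · rintro ⟨i, hi, rfl⟩
    exact hi
  · intro hj
    obtain ⟨i, rfl⟩ := hB j hj
    exact ⟨i, hj, rfl⟩

theorem IsNCPairingOn.pullBlocks {w v : List Bool} {π : Finset (Finset (Fin w.length))}
    (hπ : IsNCPairingOn w π) (e : Fin v.length ↪ Fin w.length)
    (hget : ∀ i, w.get (e i) = v.get i)
    (hcyc : ∀ a b c d : Fin v.length, a < b → b < c → c < d →
      (e a < e b ∧ e b < e c ∧ e c < e d) ∨ (e d < e a ∧ e a < e b ∧ e b < e c))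
    (hclosed : ∀ B ∈ π, ∀ i ∈ B, i ∈ Set.range e → ∀ j ∈ B, j ∈ Set.range e) :
    IsNCPairingOn v (pullBlocks e π) := by
  obtain ⟨⟨hcard, huniq⟩, hnc, hlet⟩ := hπ
  refine ⟨⟨?_, ?_⟩, ?_, ?_⟩
  · intro B hB
    simp only [_root_.pullBlocks, Finset.mem_filter, Finset.mem_univ, true_and] at hB
    simpa using hcard _ hB
  · intro i
    obtain ⟨B, ⟨hB, hiB⟩, hu⟩ := huniq (e i)
    obtain ⟨A, rfl⟩ := exists_map_eq e B (hclosed B hB _ hiB ⟨i, rfl⟩)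
    refine ⟨A, ⟨by simpa [_root_.pullBlocks] using hB, by simpa using hiB⟩, ?_⟩
    rintro C ⟨hC, hiC⟩
    simp only [_root_.pullBlocks, Finset.mem_filter, Finset.mem_univ, true_and] at hC
    exact Finset.map_injective e (hu _ ⟨hC, by simpa using hiC⟩)
  · rintro ⟨B, hB, C, hC, a, c, b, d, ha, hc, hb, hd, hab, hbc, hcd⟩
    simp only [_root_.pullBlocks, Finset.mem_filter, Finset.mem_univ, true_and] at hB hC
    rcases hcyc a b c d hab hbc hcd with ⟨h1, h2, h3⟩ | ⟨h1, h2, h3⟩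
    · exact hnc ⟨_, hB, _, hC, e a, e c, e b, e d, by simpa, by simpa, by simpa, by simpa,
        h1, h2, h3⟩
    · exact hnc ⟨_, hC, _, hB, e d, e b, e a, e c, by simpa, by simpa, by simpa, by simpa,
        h1, h2, h3⟩
  · intro B hB i hi j hj hij
    simp only [_root_.pullBlocks, Finset.mem_filter, Finset.mem_univ, true_and] at hB
    rw [← hget, ← hget]
    exact hlet _ hB _ (by simpa) _ (by simpa) (by simpa)

theorem mem_of_pullBlocks_eq {M N : ℕ} (e : Fin M ↪ Fin N) {π ρ : Finset (Finset (Fin N))}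
    (h : pullBlocks e π = pullBlocks e ρ) {B : Finset (Fin N)} (hB : B ∈ π)
    (hr : ∀ j ∈ B, j ∈ Set.range e) : B ∈ ρ := by
  obtain ⟨A, rfl⟩ := exists_map_eq e B hr
  have : A ∈ pullBlocks e π := by simpa [pullBlocks] using hB
  rw [h] at this
  simpa [pullBlocks] using this

theorem phi_nil_le : phi [] ≤ 1 := by
  refine Set.ncard_le_one (Set.toFinite _) |>.2 ?_
  have key : ∀ π : Finset (Finset (Fin ([] : List Bool).length)), IsNCPairingOn [] π → π = ∅ := by
    intro π hπ
    refine Finset.eq_empty_of_forall_notMem fun B hB => ?_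
    obtain ⟨x, -⟩ := Finset.card_pos.1 ((hπ.1.1 B hB).symm ▸ Nat.two_pos)
    exact x.elim0
  intro π hπ ρ hρ
  rw [key π hπ, key ρ hρ]

theorem phi_cons_le_phi_concat (b : Bool) (u : List Bool) : phi (b :: u) ≤ phi (u ++ [b]) := by
  have hlen : (u ++ [b]).length = u.length + 1 := by simp
  let f : Fin (u ++ [b]).length → Fin (b :: u).length := fun i =>
    if h : i.val < u.length then ⟨i.val + 1, by simpa using h⟩ else ⟨0, by simp⟩
  have hf : ∀ i, (f i).val = if i.val < u.length then i.val + 1 else 0 := by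
    intro i
    simp only [f]
    split_ifs <;> rfl
  have hinj : Function.Injective f := by
    intro i j hij
    have h := congrArg Fin.val hij
    rw [hf, hf] at h
    have := i.isLt
    have := j.isLt
    ext
    split_ifs at h <;> omega
  let e : Fin (u ++ [b]).length ↪ Fin (b :: u).length := ⟨f, hinj⟩
  have hsurj : ∀ j, j ∈ Set.range e := by
    intro j
    have hj : j.val < u.length + 1 := by simpa using j.isLt
    by_cases h0 : j.val = 0
    · refine ⟨⟨u.length, by simp⟩, Fin.ext ?_⟩
      change (f _).val = _
      rw [hf]
      simp [h0]
    · refine ⟨⟨j.val - 1, by omega⟩, Fin.ext ?_⟩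
      change (f _).val = _
      rw [hf]
      simp only
      split_ifs <;> omega
  refine Set.ncard_le_ncard_of_injOn (pullBlocks e) ?_ ?_ (Set.toFinite _)
  · intro π hπ
    refine IsNCPairingOn.pullBlocks hπ e ?_ ?_ fun _ _ _ _ _ j _ => hsurj j
    · intro i
      have hi := hf i
      change (b :: u).get (f i) = _
      by_cases h : i.val < u.length
      · simp only [h, if_true] at hi
        simp [List.get_eq_getElem, hi, List.getElem_append_left h]
      · simp only [h, if_false] at hi
        have : i.val = u.length := by omega
        simp [List.get_eq_getElem, hi, this]
    · intro p q s t hpq hqs hst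
      change (f p < f q ∧ f q < f s ∧ f s < f t) ∨ (f t < f p ∧ f p < f q ∧ f q < f s)
      simp only [Fin.lt_def, hf] at *
      have := t.isLt
      split_ifs <;> omega
  · intro π _ ρ _ h
    refine Finset.Subset.antisymm ?_ ?_
    · exact fun B hB => mem_of_pullBlocks_eq e h hB fun j _ => hsurj j
    · exact fun B hB => mem_of_pullBlocks_eq e h.symm hB fun j _ => hsurj j

/-- The pairings of `w` in which positions `p` and `q` share a block. -/
def pairingsJoining (w : List Bool) (p q : ℕ) : Set (Finset (Finset (Fin w.length))) :=
  {π | IsNCPairingOn w π ∧ ∃ B ∈ π, ∃ i ∈ B, ∃ j ∈ B, i.val = p ∧ j.val = q}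

theorem ncard_pairingsJoining_le (b c : Bool) (x y : List Bool) :
    (pairingsJoining (b :: (x ++ c :: y)) 0 (x.length + 1)).ncard ≤ phi x * phi y := by
  set w := b :: (x ++ c :: y) with hw
  have hlen : w.length = x.length + y.length + 2 := by simp [hw]; omega
  let e₁ : Fin x.length ↪ Fin w.length :=
    ⟨fun i => ⟨i.val + 1, by omega⟩, fun i j h => by simpa [Fin.ext_iff] using h⟩
  let e₂ : Fin y.length ↪ Fin w.length :=
    ⟨fun i => ⟨i.val + (x.length + 2), by omega⟩, fun i j h => by simpa [Fin.ext_iff] using h⟩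
  have he₁ : ∀ i, (e₁ i).val = i.val + 1 := fun i => rfl
  have he₂ : ∀ i, (e₂ i).val = i.val + (x.length + 2) := fun i => rfl
  have hr₁ : ∀ j, j ∈ Set.range e₁ ↔ 0 < j.val ∧ j.val < x.length + 1 := by
    intro j
    constructor
    · rintro ⟨i, rfl⟩
      rw [he₁]
      omega
    · rintro ⟨h0, h1⟩
      exact ⟨⟨j.val - 1, by omega⟩, Fin.ext (by rw [he₁]; simp only; omega)⟩
  have hr₂ : ∀ j, j ∈ Set.range e₂ ↔ x.length + 1 < j.val := by
    intro j
    constructor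
    · rintro ⟨i, rfl⟩
      rw [he₂]
      omega
    · intro h
      exact ⟨⟨j.val - (x.length + 2), by omega⟩, Fin.ext (by rw [he₂]; simp only; omega)⟩
  let z : Fin w.length := ⟨0, by omega⟩
  let p : Fin w.length := ⟨x.length + 1, by omega⟩
  have hzp : z ≠ p := by simp [z, p, Fin.ext_iff]
  have hblock : ∀ π ∈ pairingsJoining w 0 (x.length + 1), {z, p} ∈ π := by
    rintro π ⟨hπ, B, hB, i, hi, j, hj, hi0, hj0⟩
    obtain rfl : i = z := Fin.ext hi0
    obtain rfl : j = p := Fin.ext hj0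
    have : ({z, p} : Finset _) = B := by
      refine Finset.eq_of_subset_of_card_le ?_ ?_
      · intro k hk
        simp only [Finset.mem_insert, Finset.mem_singleton] at hk
        rcases hk with rfl | rfl <;> assumption
      · rw [hπ.1.1 B hB, Finset.card_pair hzp]
    exact this ▸ hB
  have htri : ∀ π ∈ pairingsJoining w 0 (x.length + 1), ∀ B ∈ π,
      B = {z, p} ∨ (∀ j ∈ B, j ∈ Set.range e₁) ∨ (∀ j ∈ B, j ∈ Set.range e₂) := by
    intro π hπ B hB
    by_cases hBz : B = {z, p}
    · exact Or.inl hBz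
    right
    have hzpB := hblock π hπ
    obtain ⟨⟨hcard, huniq⟩, hnc, -⟩ := hπ.1
    have hne : ∀ k ∈ B, k.val ≠ 0 ∧ k.val ≠ x.length + 1 := by
      intro k hk
      constructor
      · intro h
        obtain rfl : k = z := Fin.ext h
        exact hBz ((huniq z).unique ⟨hB, hk⟩ ⟨hzpB, by simp⟩)
      · intro h
        obtain rfl : k = p := Fin.ext h
        exact hBz ((huniq p).unique ⟨hB, hk⟩ ⟨hzpB, by simp⟩)
    have hno : ∀ k ∈ B, ∀ l ∈ B, k.val < x.length + 1 → ¬ x.length + 1 < l.val := by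
      intro k hk l hl h1 h2
      refine hnc ⟨_, hzpB, B, hB, z, p, k, l, by simp, by simp, hk, hl, ?_, ?_, ?_⟩
      · have := (hne k hk).1
        simp only [Fin.lt_def, z]
        omega
      · simpa [Fin.lt_def, p] using h1
      · simpa [Fin.lt_def, p] using h2
    by_cases h : ∃ k ∈ B, k.val < x.length + 1
    · obtain ⟨k, hk, hkx⟩ := h
      left
      intro j hj
      rw [hr₁]
      have := hno k hk j hj hkx
      have := hne j hj
      omega
    · right
      intro j hj
      rw [hr₂]
      have : ¬ j.val < x.length + 1 := fun hh => h ⟨j, hj, hh⟩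
      have := hne j hj
      omega
  have hdisj : ∀ j, j ∈ Set.range e₁ → j ∈ Set.range e₂ → False := by
    intro j h1 h2
    rw [hr₁] at h1
    rw [hr₂] at h2
    omega
  have hzp' : ∀ j ∈ ({z, p} : Finset (Fin w.length)),
      j ∉ Set.range e₁ ∧ j ∉ Set.range e₂ := by
    intro j hj
    rw [hr₁, hr₂]
    simp only [Finset.mem_insert, Finset.mem_singleton] at hj
    rcases hj with rfl | rfl <;> simp [z, p]
  have hsub : ∀ π ∈ pairingsJoining w 0 (x.length + 1),
      ∀ ρ ∈ pairingsJoining w 0 (x.length + 1),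
      pullBlocks e₁ π = pullBlocks e₁ ρ → pullBlocks e₂ π = pullBlocks e₂ ρ → π ⊆ ρ := by
    intro π hπ ρ hρ h1 h2 B hB
    rcases htri π hπ B hB with rfl | h | h
    · exact hblock ρ hρ
    · exact mem_of_pullBlocks_eq e₁ h1 hB h
    · exact mem_of_pullBlocks_eq e₂ h2 hB h
  unfold phi
  rw [← Set.ncard_prod]
  refine Set.ncard_le_ncard_of_injOn (fun π => (pullBlocks e₁ π, pullBlocks e₂ π)) ?_ ?_
    (Set.toFinite _)
  · intro π hπ
    refine Set.mk_mem_prod ?_ ?_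
    · refine IsNCPairingOn.pullBlocks hπ.1 e₁ ?_ ?_ ?_
      · intro i
        simp [List.get_eq_getElem, he₁, hw]
      · intro a b c d hab hbc hcd
        simp only [Fin.lt_def, he₁] at *
        omega
      · intro B hB i hi hir
        rcases htri π hπ B hB with rfl | h | h
        · exact absurd hir (hzp' i hi).1
        · exact h
        · exact (hdisj i hir (h i hi)).elim
    · refine IsNCPairingOn.pullBlocks hπ.1 e₂ ?_ ?_ ?_
      · intro i
        have h2 : i.val + (x.length + 2) = (x.length + (i.val + 1)) + 1 := by omega
        simp [List.get_eq_getElem, he₂, hw, h2]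
      · intro a b c d hab hbc hcd
        simp only [Fin.lt_def, he₂] at *
        omega
      · intro B hB i hi hir
        rcases htri π hπ B hB with rfl | h | h
        · exact absurd hir (hzp' i hi).2
        · exact (hdisj i (h i hi) hir).elim
        · exact h
  · intro π hπ ρ hρ h
    simp only [Prod.mk.injEq] at h
    exact Finset.Subset.antisymm (hsub π hπ ρ hρ h.1 h.2) (hsub ρ hρ π hπ h.1.symm h.2.symm)

theorem phi_cons_le (b : Bool) (u : List Bool) :
    phi (b :: u) ≤ ∑ i ∈ (Finset.range u.length).filter (fun i => u[i]? = some (!b)),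
      phi (u.take i) * phi (u.drop (i + 1)) := by
  set S := (Finset.range u.length).filter (fun i => u[i]? = some (!b)) with hS
  have hcover : {π | IsNCPairingOn (b :: u) π} ⊆
      ⋃ i ∈ S, pairingsJoining (b :: u) 0 (i + 1) := by
    intro π hπ
    let z : Fin (b :: u).length := ⟨0, by simp⟩
    obtain ⟨B, ⟨hB, hz⟩, -⟩ := hπ.1.2 z
    obtain ⟨q, hq, hqz⟩ := Finset.exists_mem_ne (by rw [hπ.1.1 B hB]; norm_num) z
    have hlet := hπ.2.2 B hB z hz q hq hqz.symm
    have hq0 : q.val ≠ 0 := fun h => hqz (Fin.ext h)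
    have hql : q.val < u.length + 1 := by simpa using q.isLt
    obtain ⟨i, hi⟩ := Nat.exists_eq_succ_of_ne_zero hq0
    have hiu : i < u.length := by omega
    simp only [Set.mem_iUnion]
    refine ⟨i, ?_, hπ, B, hB, z, hz, q, hq, rfl, hi⟩
    simp only [hS, Finset.mem_filter, Finset.mem_range]
    refine ⟨hiu, ?_⟩
    rw [List.getElem?_eq_getElem hiu]
    simp only [List.get_eq_getElem, z, hi, List.getElem_cons_zero, Nat.succ_eq_add_one,
      List.getElem_cons_succ] at hlet
    revert hlet
    cases b <;> cases u[i] <;> simp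
  calc phi (b :: u) ≤ (⋃ i ∈ S, pairingsJoining (b :: u) 0 (i + 1)).ncard :=
        Set.ncard_le_ncard hcover (Set.toFinite _)
    _ ≤ ∑ i ∈ S, (pairingsJoining (b :: u) 0 (i + 1)).ncard := by
        classical
        refine Finset.induction_on S (by simp) fun a s ha ih => ?_
        rw [Finset.set_biUnion_insert, Finset.sum_insert ha]
        exact (Set.ncard_union_le _ _).trans (by gcongr)
    _ ≤ _ := by
        refine Finset.sum_le_sum fun i hi => ?_
        have hiu : i < u.length := by
          simp only [hS, Finset.mem_filter, Finset.mem_range] at hi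
          exact hi.1
        have h := ncard_pairingsJoining_le b u[i] (u.take i) (u.drop (i + 1))
        rwa [List.getElem_cons_drop, List.take_append_drop, List.length_take,
          min_eq_left hiu.le] at h

theorem take_append_of_getElem? {u : List Bool} {i : ℕ} {b : Bool} (h : u[i]? = some b) :
    u = u.take i ++ b :: u.drop (i + 1) := by
  obtain ⟨hi, rfl⟩ := List.getElem?_eq_some_iff.1 h
  rw [List.getElem_cons_drop, List.take_append_drop]

theorem count_eq_of_phi_ne_zero (w : List Bool) (h : phi w ≠ 0) :
    w.count true = w.count false := by
  induction hn : w.length using Nat.strong_induction_on generalizing w with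
  | _ n ih =>
    cases w with
    | nil => rfl
    | cons b u =>
      have hs := (Nat.pos_of_ne_zero h).trans_le (phi_cons_le b u)
      obtain ⟨i, hi, hpos⟩ := Finset.exists_ne_zero_of_sum_ne_zero hs.ne'
      simp only [Finset.mem_filter, Finset.mem_range] at hi
      have hu := take_append_of_getElem? hi.2
      simp only [List.length_cons] at hn
      have h1 := ih _ (by rw [List.length_take]; omega) (u.take i)
        (left_ne_zero_of_mul hpos) rfl
      have h2 := ih _ (by rw [List.length_drop]; omega) (u.drop (i + 1))
        (right_ne_zero_of_mul hpos) rfl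
      have ht := congrArg (List.count true) hu
      have hf := congrArg (List.count false) hu
      cases b <;> simp at ht hf ⊢ <;> omega

theorem exists_of_replicate_append_eq {n : ℕ} {u x y : List Bool}
    (h : List.replicate n true ++ u = x ++ false :: y) :
    ∃ x', x = List.replicate n true ++ x' ∧ u = x' ++ false :: y := by
  rcases List.append_eq_append_iff.1 h with ⟨t, ht, ht'⟩ | ⟨t, ht, ht'⟩
  · exact ⟨t, ht, ht'⟩
  · cases t with
    | nil => exact ⟨[], by simpa using ht.symm, by simpa using ht'.symm⟩
    | cons c t =>
      simp only [List.cons_append, List.cons.injEq] at ht'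
      have : c ∈ List.replicate n true := ht ▸ by simp
      rw [List.mem_replicate] at this
      simp [← ht'.1] at this

/-- `HasRuns L w`: the word `w` consists of runs of ones of lengths `L`, with zeros interspersed
before, between and after the runs. -/
inductive HasRuns : List ℕ → List Bool → Prop
  | nil : HasRuns [] []
  | zero {L : List ℕ} {u : List Bool} : HasRuns L u → HasRuns L (false :: u)
  | run {L : List ℕ} {u : List Bool} (n : ℕ) :
      HasRuns L u → HasRuns (n :: L) (List.replicate n true ++ u)

namespace HasRuns

theorem count_true {L : List ℕ} {u : List Bool} (h : HasRuns L u) : u.count true = L.sum := by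
  induction h with
  | nil => rfl
  | zero _ ih => simpa using ih
  | run n _ ih => simp [ih]

theorem replicate_append {L : List ℕ} {u : List Bool} (h : HasRuns L u) (a : ℕ) :
    HasRuns L (List.replicate a false ++ u) := by
  induction a with
  | zero => simpa
  | succ a ih => simpa [List.replicate_succ] using ih.zero

theorem concat {L : List ℕ} {u : List Bool} (h : HasRuns L u) : HasRuns L (u ++ [false]) := by
  induction h with
  | nil => exact HasRuns.nil.zero
  | zero _ ih => exact ih.zero
  | run n _ ih =>
    rw [List.append_assoc]
    exact ih.run n

theorem split {L : List ℕ} {u : List Bool} (h : HasRuns L u) (x y : List Bool)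
    (hu : u = x ++ false :: y) :
    ∃ j ≤ L.length, HasRuns (L.take j) x ∧ HasRuns (L.drop j) y := by
  induction h generalizing x with
  | nil => simp at hu
  | @zero L u h ih =>
    cases x with
    | nil =>
      simp only [List.nil_append, List.cons.injEq, true_and] at hu
      exact ⟨0, by simp, by simpa using HasRuns.nil, by simpa [← hu] using h⟩
    | cons b x =>
      simp only [List.cons_append, List.cons.injEq] at hu
      obtain ⟨j, hj, h1, h2⟩ := ih x hu.2
      exact ⟨j, hj, hu.1 ▸ h1.zero, h2⟩
  | @run L u n h ih =>
    obtain ⟨x', rfl, hu'⟩ := exists_of_replicate_append_eq hu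
    obtain ⟨j, hj, h1, h2⟩ := ih x' hu'
    exact ⟨j + 1, by simpa using hj, by simpa using h1.run n, by simpa using h2⟩

theorem exists_eq_replicate_append {L : List ℕ} {u : List Bool} (h : HasRuns L u) :
    L = [] ∨ ∃ a n L' v, L = n :: L' ∧ HasRuns L' v ∧
      u = List.replicate a false ++ (List.replicate n true ++ v) := by
  induction h with
  | nil => exact Or.inl rfl
  | zero _ ih =>
    rcases ih with rfl | ⟨a, n, L', v, rfl, hv, rfl⟩
    · exact Or.inl rfl
    · exact Or.inr ⟨a + 1, n, L', v, rfl, hv, by simp [List.replicate_succ]⟩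
  | run n h _ => exact Or.inr ⟨0, n, _, _, rfl, h, by simp⟩

theorem exists_phi_replicate_append_le {L : List ℕ} {v : List Bool} (h : HasRuns L v) (a n : ℕ) :
    ∃ v', HasRuns L v' ∧ phi (List.replicate a false ++ (List.replicate n true ++ v)) ≤
      phi (List.replicate n true ++ v') := by
  induction a generalizing v with
  | zero => exact ⟨v, h, by simp⟩
  | succ a ih =>
    obtain ⟨v', hv', hle⟩ := ih h.concat
    refine ⟨v', hv', le_trans ?_ hle⟩
    simpa [List.replicate_succ] using
      phi_cons_le_phi_concat false (List.replicate a false ++ (List.replicate n true ++ v))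

theorem phi_replicate_append_le_rootCount {L : List ℕ}
    (hL : ∀ K : List ℕ, K.length ≤ L.length → ∀ u, HasRuns K u → phi u ≤ rootCount 0 K)
    (k : ℕ) {u : List Bool} (hu : HasRuns L u) :
    phi (List.replicate k true ++ u) ≤ rootCount k L := by
  induction k generalizing L u with
  | zero => simpa using hL L le_rfl u hu
  | succ k ih =>
    rw [List.replicate_succ, List.cons_append]
    refine (phi_cons_le _ _).trans ?_
    set w := List.replicate k true ++ u with hw
    rw [rootCount_succ, Bool.not_true]
    set S := (Finset.range w.length).filter (fun i => w[i]? = some false) with hS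
    have hsplit : ∀ i ∈ S, ∃ j ≤ L.length, HasRuns (L.drop j) (w.drop (i + 1)) ∧
        phi (w.take i) ≤ rootCount k (L.take j) := by
      intro i hi
      simp only [hS, Finset.mem_filter, Finset.mem_range] at hi
      obtain ⟨x, hx, hux⟩ := exists_of_replicate_append_eq (take_append_of_getElem? hi.2)
      obtain ⟨j, hj, h1, h2⟩ := hu.split x _ hux
      refine ⟨j, hj, h2, hx ▸ ih (fun K hK => hL K (hK.trans ?_)) h1⟩
      simp
    choose! j hj hdrop htake using hsplit
    have hlen : ∀ i ∈ S, phi (w.drop (i + 1)) ≠ 0 →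
        w.length - (i + 1) = 2 * (L.drop (j i)).sum := by
      intro i hi hne
      rw [← (hdrop i hi).count_true, ← List.length_drop, ← List.count_true_add_count_false,
        ← count_eq_of_phi_ne_zero _ hne]
      ring
    have hinj : Set.InjOn j (S.filter fun i => phi (w.drop (i + 1)) ≠ 0 : Finset ℕ) := by
      intro p hp q hq hpq
      simp only [Finset.coe_filter, Set.mem_ofPred_eq] at hp hq
      have h1 := hlen p hp.1 hp.2
      have h2 := hlen q hq.1 hq.2
      have hp' := hp.1
      have hq' := hq.1
      simp only [hS, Finset.mem_filter, Finset.mem_range] at hp' hq'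
      rw [hpq] at h1
      omega
    calc ∑ i ∈ S, phi (w.take i) * phi (w.drop (i + 1))
        = ∑ i ∈ S.filter (fun i => phi (w.drop (i + 1)) ≠ 0),
            phi (w.take i) * phi (w.drop (i + 1)) :=
          (Finset.sum_filter_of_ne fun i _ h => right_ne_zero_of_mul h).symm
      _ ≤ ∑ i ∈ S.filter (fun i => phi (w.drop (i + 1)) ≠ 0),
            rootCount k (L.take (j i)) * rootCount 0 (L.drop (j i)) := by
          refine Finset.sum_le_sum fun i hi => ?_
          have hi := (Finset.mem_filter.1 hi).1
          exact Nat.mul_le_mul (htake i hi) (hL _ (by simp) _ (hdrop i hi))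
      _ = ∑ l ∈ (S.filter fun i => phi (w.drop (i + 1)) ≠ 0).image j,
            rootCount k (L.take l) * rootCount 0 (L.drop l) := by
          rw [Finset.sum_image hinj]
      _ ≤ _ := by
          refine Finset.sum_le_sum_of_subset fun l hl => ?_
          obtain ⟨i, hi, rfl⟩ := Finset.mem_image.1 hl
          have := hj i (Finset.mem_filter.1 hi).1
          exact Finset.mem_range.2 (by omega)

theorem phi_le_rootCount {L : List ℕ} {u : List Bool} (hu : HasRuns L u) :
    phi u ≤ rootCount 0 L := by
  induction hN : L.length using Nat.strong_induction_on generalizing L u with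
  | _ N ih =>
    rcases hu.exists_eq_replicate_append with rfl | ⟨a, n, L', v, rfl, hv, rfl⟩
    · have h1 : rootCount 0 [] = 1 := by simp [rootCount_zero, forestCount]
      rw [h1]
      by_cases h0 : phi u = 0
      · omega
      · have ht := hu.count_true
        have hf := count_eq_of_phi_ne_zero u h0
        have hl := List.count_true_add_count_false (l := u)
        rw [← hf, ht] at hl
        obtain rfl : u = [] := List.length_eq_zero_iff.1 (by simpa using hl.symm)
        exact phi_nil_le
    · obtain ⟨v', hv', hle⟩ := exists_phi_replicate_append_le hv a n
      rw [rootCount_zero_cons]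
      refine hle.trans (phi_replicate_append_le_rootCount (fun K hK w hw => ?_) n hv')
      exact ih K.length (by simp only [List.length_cons] at hN; omega) hw rfl

end HasRuns

theorem hasRuns_runsF {r : ℕ} (n m : Fin r → ℕ) : HasRuns (List.ofFn n) (runsF n m) := by
  induction r with
  | zero => simpa [runsF] using HasRuns.nil
  | succ r ih =>
    have h := ih (fun i => n i.succ) (fun i => m i.succ)
    have hr : runsF n m = List.replicate (n 0) true ++
        (List.replicate (m 0) false ++ runsF (fun i => n i.succ) (fun i => m i.succ)) := by
      simp [runsF, List.finRange_succ, List.flatMap_map]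
    rw [hr, List.ofFn_succ]
    exact (h.replicate_append _).run _

/-- `d` is the preorder degree sequence of a plane forest with `s` trees. -/
def IsForestSeq {r : ℕ} (s : ℕ) (d : Fin r → ℕ) : Prop :=
  (∀ i < r, i < s + prefSum d i) ∧ s + ∑ j, d j = r

theorem prefSum_zero {r : ℕ} (d : Fin r → ℕ) : prefSum d 0 = 0 := by
  simp [prefSum]

theorem prefSum_succ {r : ℕ} (d : Fin (r + 1) → ℕ) (i : ℕ) :
    prefSum d (i + 1) = d 0 + prefSum (fun j => d j.succ) i := by
  simp [prefSum, Finset.sum_filter, Fin.sum_univ_succ]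

theorem isForestSeq_succ {r : ℕ} (s : ℕ) (d : Fin (r + 1) → ℕ) :
    IsForestSeq (s + 1) d ↔ IsForestSeq (s + d 0) (fun j => d j.succ) := by
  simp only [IsForestSeq, Fin.sum_univ_succ]
  constructor
  · rintro ⟨h1, h2⟩
    refine ⟨fun i hi => ?_, by omega⟩
    have := h1 (i + 1) (by omega)
    rw [prefSum_succ] at this
    omega
  · rintro ⟨h1, h2⟩
    refine ⟨fun i hi => ?_, by omega⟩
    cases i with
    | zero => omega
    | succ i =>
      have := h1 i (by omega)
      rw [prefSum_succ]
      omega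

theorem not_isForestSeq_zero {r : ℕ} (d : Fin (r + 1) → ℕ) : ¬ IsForestSeq 0 d := by
  rintro ⟨h, -⟩
  simpa [prefSum_zero] using h 0 (by omega)

open Classical in
theorem forestCount_ofFn {r : ℕ} (n : Fin r → ℕ) (s : ℕ) :
    forestCount (List.ofFn n) s = ∑ d : ((i : Fin r) → Fin (n i + 2)),
      if IsForestSeq s (fun i => (d i : ℕ)) then ∏ i, (n i + 1).choose (d i) else 0 := by
  induction r generalizing s with
  | zero => cases s <;> simp [forestCount, IsForestSeq]
  | succ r ih =>
    rw [List.ofFn_succ]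
    cases s with
    | zero => simp [forestCount, not_isForestSeq_zero]
    | succ s =>
      rw [forestCount, ← (Fin.consEquiv fun i => Fin (n i + 2)).sum_comp, Fintype.sum_prod_type,
        Finset.sum_range]
      refine Finset.sum_congr rfl fun a _ => ?_
      rw [ih, Finset.mul_sum]
      refine Finset.sum_congr rfl fun d _ => ?_
      simp [isForestSeq_succ, Fin.consEquiv, Fin.prod_univ_succ]

theorem isCatalanSeq_iff {r : ℕ} (hr : 1 ≤ r) (d : Fin r → ℕ) :
    IsCatalanSeq r d ↔ IsForestSeq 1 d := by
  unfold IsCatalanSeq IsForestSeq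
  refine and_congr ⟨fun h i hi => ?_, fun h i hi hir => ?_⟩ (by omega)
  · rcases Nat.eq_zero_or_pos i with rfl | hi0
    · omega
    · have := h i hi0 (by omega)
      unfold prefSum
      omega
  · have := h i (by omega)
    unfold prefSum at this
    omega

theorem finite_isCatalanSeq (r : ℕ) : {d : Fin r → ℕ | IsCatalanSeq r d}.Finite := by
  refine (Set.finite_Iic (fun _ : Fin r => r - 1)).subset fun d hd i => ?_
  exact (Finset.single_le_sum (fun _ _ => Nat.zero_le _) (Finset.mem_univ i)).trans hd.2.le

theorem forestCount_one_le {r : ℕ} (hr : 1 ≤ r) (n : Fin r → ℕ) :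
    forestCount (List.ofFn n) 1 ≤
      ∑ᶠ d ∈ {d : Fin r → ℕ | IsCatalanSeq r d}, ∏ i, (n i + 1).choose (d i) := by
  classical
  rw [forestCount_ofFn, ← Finset.sum_filter,
    finsum_mem_eq_finite_toFinset_sum _ (finite_isCatalanSeq r)]
  have hinj : Function.Injective
      fun (d : (i : Fin r) → Fin (n i + 2)) (i : Fin r) => (d i : ℕ) :=
    fun d d' h => funext fun i => Fin.ext (congrFun h i)
  rw [← Finset.sum_image (s := Finset.univ.filter fun d : (i : Fin r) → Fin (n i + 2) =>
      IsForestSeq 1 fun i => (d i : ℕ)) (f := fun d => ∏ i, (n i + 1).choose (d i))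
      (hinj.injOn)]
  refine Finset.sum_le_sum_of_subset fun d hd => ?_
  obtain ⟨c, hc, rfl⟩ := Finset.mem_image.1 hd
  simpa [isCatalanSeq_iff hr] using hc

/-- For positive `n_i` and nonnegative `m₀, m₁, …, m_r` with
`m₀ + ⋯ + m_r = n₁ + ⋯ + n_r`,
`φ(0^{m₀}1^{n₁}0^{m₁}⋯1^{n_r}0^{m_r}) ≤ Σ_{d ∈ D_r} Π_i C(n_i + 1, d_i)`. -/
theorem stmt16 (r : ℕ) (hr : 1 ≤ r) (n : Fin r → ℕ) (hn : ∀ i, 1 ≤ n i)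
    (m0 : ℕ) (m : Fin r → ℕ) (hsum : m0 + ∑ i, m i = ∑ i, n i) :
    phi (List.replicate m0 false ++ runsF n m) ≤
      ∑ᶠ d ∈ {d : Fin r → ℕ | IsCatalanSeq r d}, ∏ i, (n i + 1).choose (d i) := by
  refine ((hasRuns_runsF n m).replicate_append m0).phi_le_rootCount.trans ?_
  refine le_trans (le_of_eq ?_) (forestCount_one_le hr n)
  obtain ⟨r, rfl⟩ := Nat.exists_eq_add_of_le' hr
  simp [rootCount_zero, List.ofFn_succ, forestCount]
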